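/- Let X be a random vector in ℝ^d with characteristic function φ(t) = E[e^{i⟨t,X⟩}], and let S be a Bernoulli(q) random variable with q ∈ (0,1] that is independent of X. Define, for t ∈ ℝ^d, h(t) = (cos⟨t,X⟩ + sin⟨t,X⟩ − Re φ(t) − Im φ(t)) · S/√q. Then for all t ∈ ℝ^d, E[h(t)] = 0, and for all s,t ∈ ℝ^d, E[h(t) h(s)] = Re φ(t−s) + Im φ(t+s) − Re φ(t) Re φ(s) − Im φ(t) Re φ(s) − Re φ(t) Im φ(s) − Im φ(t) Im φ(s). In particular the covariance does not depend on q. -/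

import Mathlib

open MeasureTheory ProbabilityTheory
open scoped RealInnerProductSpace

theorem integrable_of_continuous_of_abs_le {E Ω : Type*} [TopologicalSpace E] [MeasurableSpace E]
    [OpensMeasurableSpace E] [MeasurableSpace Ω] {P : Measure Ω} [IsFiniteMeasure P]
    {X : Ω → E} (hX : Measurable X) {f : E → ℝ} (hf : Continuous f) {C : ℝ}
    (hC : ∀ x, |f x| ≤ C) : Integrable (fun ω => f (X ω)) P :=
  Integrable.of_bound (hf.measurable.comp hX).aestronglyMeasurable C (ae_of_all _ fun ω => hC (X ω))

theorem integral_eq_of_zero_or_one {Ω : Type*} [MeasurableSpace Ω] {P : Measure Ω}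
    {S : Ω → ℝ} (hS : Measurable S) (hS01 : ∀ ω, S ω = 0 ∨ S ω = 1) :
    ∫ ω, S ω ∂P = P.real {ω | S ω = 1} := by
  have hind : S = Set.indicator {ω | S ω = 1} 1 := by
    funext ω
    rcases hS01 ω with h | h <;> simp [Set.indicator, h]
  conv_lhs => rw [hind]
  exact integral_indicator_one (hS (measurableSet_singleton 1))

section CharacteristicFunction

variable {E Ω : Type*} [NormedAddCommGroup E] [InnerProductSpace ℝ E] [MeasurableSpace E]
  [OpensMeasurableSpace E] [MeasurableSpace Ω] {P : Measure Ω} [IsFiniteMeasure P] {X : Ω → E}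

theorem integrable_cos_inner (hX : Measurable X) (t : E) :
    Integrable (fun ω => Real.cos ⟪t, X ω⟫) P :=
  integrable_of_continuous_of_abs_le (f := fun x => Real.cos ⟪t, x⟫) hX (by fun_prop)
    fun _ => Real.abs_cos_le_one _

theorem integrable_sin_inner (hX : Measurable X) (t : E) :
    Integrable (fun ω => Real.sin ⟪t, X ω⟫) P :=
  integrable_of_continuous_of_abs_le (f := fun x => Real.sin ⟪t, x⟫) hX (by fun_prop)
    fun _ => Real.abs_sin_le_one _

theorem integral_exp_I_mul_inner (hX : Measurable X) (t : E) :
    ∫ ω, Complex.exp (Complex.I * (⟪t, X ω⟫ : ℝ)) ∂P =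
      ⟨∫ ω, Real.cos ⟪t, X ω⟫ ∂P, ∫ ω, Real.sin ⟪t, X ω⟫ ∂P⟩ := by
  have hexp (ω : Ω) : Complex.exp (Complex.I * (⟪t, X ω⟫ : ℝ)) =
      (Real.cos ⟪t, X ω⟫ : ℂ) + (Real.sin ⟪t, X ω⟫ : ℂ) * Complex.I := by
    rw [mul_comm, Complex.exp_mul_I, Complex.ofReal_cos, Complex.ofReal_sin]
  simp_rw [hexp]
  rw [integral_add (integrable_cos_inner hX t).ofReal
    ((integrable_sin_inner hX t).ofReal.mul_const _), integral_mul_const,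
    integral_complex_ofReal, integral_complex_ofReal, Complex.mk_eq_add_mul_I]

end CharacteristicFunction

/-- for a random vector `X` in ℝ^d with characteristic function `φ` and an
independent Bernoulli(q) complete-case indicator `S` (q ∈ (0,1]), the random function
`h(t) = (cos⟨t,X⟩ + sin⟨t,X⟩ − Re φ(t) − Im φ(t))·S/√q` is centered and its covariance
`E[h(t)h(s)]` equals the stated expression, which does not depend on `q`. -/
theorem cc_process_mean_and_covariance {d : ℕ} {Ω : Type*} [MeasureSpace Ω]
    (P : Measure Ω) [IsProbabilityMeasure P]
    (X : Ω → EuclideanSpace ℝ (Fin d)) (hX : Measurable X)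
    (S : Ω → ℝ) (hS : Measurable S)
    (q : ℝ) (hq : 0 < q) (hq1 : q ≤ 1)
    (hS01 : ∀ ω, S ω = 0 ∨ S ω = 1)
    (hSq : P {ω | S ω = 1} = ENNReal.ofReal q)
    (hindep : IndepFun X S P)
    (φ : EuclideanSpace ℝ (Fin d) → ℂ)
    (hφ : ∀ t, φ t = ∫ ω, Complex.exp (Complex.I * (⟪t, X ω⟫ : ℝ)) ∂P)
    (h : EuclideanSpace ℝ (Fin d) → Ω → ℝ)
    (hdef : ∀ t ω, h t ω =
      (Real.cos ⟪t, X ω⟫ + Real.sin ⟪t, X ω⟫ - (φ t).re - (φ t).im) * S ω / Real.sqrt q) :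
    (∀ t, (∫ ω, h t ω ∂P) = 0) ∧
    (∀ s t, (∫ ω, h t ω * h s ω ∂P) =
      (φ (t - s)).re + (φ (t + s)).im
        - (φ t).re * (φ s).re - (φ t).im * (φ s).re
        - (φ t).re * (φ s).im - (φ t).im * (φ s).im) := by
  have hcos (t) : ∫ ω, Real.cos ⟪t, X ω⟫ ∂P = (φ t).re := by
    rw [hφ, integral_exp_I_mul_inner hX]
  have hsin (t) : ∫ ω, Real.sin ⟪t, X ω⟫ ∂P = (φ t).im := by
    rw [hφ, integral_exp_I_mul_inner hX]
  have hcint (t) := integrable_cos_inner (P := P) hX t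
  have hsint (t) := integrable_sin_inner (P := P) hX t
  have hES : ∫ ω, S ω ∂P = q := by
    rw [integral_eq_of_zero_or_one hS hS01, measureReal_def, hSq, ENNReal.toReal_ofReal hq.le]
  have hmul (f : EuclideanSpace ℝ (Fin d) → ℝ) (hf : Continuous f) :
      ∫ ω, f (X ω) * S ω ∂P = (∫ ω, f (X ω) ∂P) * q := by
    rw [← hES]
    exact hindep.integral_fun_comp_mul_comp hX.aemeasurable hS.aemeasurable
      hf.measurable.aestronglyMeasurable measurable_id.aestronglyMeasurable
  constructor
  · intro t
    simp_rw [hdef]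
    rw [integral_div, hmul (fun x => Real.cos ⟪t, x⟫ + Real.sin ⟪t, x⟫ - (φ t).re - (φ t).im)
      (by fun_prop)]
    have hzero : ∫ ω, (Real.cos ⟪t, X ω⟫ + Real.sin ⟪t, X ω⟫ - (φ t).re - (φ t).im) ∂P = 0 := by
      rw [integral_sub (((hcint t).fun_add (hsint t)).sub' (integrable_const _))
          (integrable_const _),
        integral_sub ((hcint t).fun_add (hsint t)) (integrable_const _),
        integral_add (hcint t) (hsint t), hcos, hsin]
      simp
    rw [hzero, zero_mul, zero_div]
  · intro s t
    let a := (φ t).re + (φ t).im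
    let b := (φ s).re + (φ s).im
    let f : EuclideanSpace ℝ (Fin d) → ℝ := fun x =>
      Real.cos ⟪t - s, x⟫ + Real.sin ⟪t + s, x⟫ - b * (Real.cos ⟪t, x⟫ + Real.sin ⟪t, x⟫)
        - a * (Real.cos ⟪s, x⟫ + Real.sin ⟪s, x⟫) + a * b
    have hprod (ω) : h t ω * h s ω = f (X ω) * S ω / q := by
      have hSS : S ω * S ω = S ω := by rcases hS01 ω with h | h <;> simp [h]
      simp only [hdef, f, a, b, inner_sub_left, inner_add_left, Real.cos_sub, Real.sin_add]
      rw [div_mul_div_comm, Real.mul_self_sqrt hq.le, mul_mul_mul_comm, hSS]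
      ring
    have hf : ∫ ω, f (X ω) ∂P = (φ (t - s)).re + (φ (t + s)).im - b * a - a * b + a * b := by
      have hI₁ := (hcint (t - s)).fun_add (hsint (t + s))
      have hI₂ := ((hcint t).fun_add (hsint t)).const_mul b
      have hI₃ := ((hcint s).fun_add (hsint s)).const_mul a
      simp only [f]
      rw [integral_add ((hI₁.sub' hI₂).sub' hI₃) (integrable_const _),
        integral_sub (hI₁.sub' hI₂) hI₃, integral_sub hI₁ hI₂,
        integral_add (hcint _) (hsint _), integral_const_mul, integral_const_mul,
        integral_add (hcint _) (hsint _), integral_add (hcint _) (hsint _)]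
      simp [hcos, hsin, a, b]
    simp_rw [hprod]
    rw [integral_div, hmul f (by fun_prop), mul_div_cancel_right₀ _ hq.ne', hf]
    ring
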